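/- Let Σ_Λ be a subshift of finite type, φ : Σ_Λ → ℝ with φ(x) = φ(y) whenever x_j = y_j for all j ≥ 0 and var_k φ ≤ b α^k for all k ≥ 0, and let μ be a Gibbs measure for φ with constants c_1, c_2, p. Let σ ∈ H be an involution with μ(Γ_σ) > 0, where Γ_σ = Σ_Λ ∩ T_σ^{-1}Σ_Λ. Then the Radon–Nikodym derivative h of the restriction of μ ∘ T_σ^{-1} to Γ_σ with respect to the restriction of μ to Γ_σ satisfies, for μ-almost every x ∈ Γ_σ, (c_1/c_2)·exp(Σ_{q∈ℤ}(φ(S^q T_σ x) − φ(S^q x))) ≤ h(x) ≤ (c_2/c_1)·exp(Σ_{q∈ℤ}(φ(S^q T_σ x) − φ(S^q x))). -/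

import Mathlib

open MeasureTheory Filter Topology

/-- The left shift on `K^ℤ`: `(S ω) n = ω (n+1)`. -/
def shiftMap (K : Type*) : (ℤ → K) → (ℤ → K) := fun ω n => ω (n + 1)

/-- For `τ : ℤ → ℤ`, the map `T_τ : K^ℤ → K^ℤ`, `(T_τ ω) n = ω (τ n)`. -/
def Tmap {K : Type*} (τ : ℤ → ℤ) (ω : ℤ → K) : ℤ → K := fun n => ω (τ n)

/-- A permutation of `ℤ` has finite support if it fixes all `n` with `|n| ≥ N` for some `N`. -/
def FinitelySupported (σ : Equiv.Perm ℤ) : Prop :=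
  ∃ N : ℕ, ∀ n : ℤ, (N : ℤ) ≤ |n| → σ n = n

/-- The subshift of finite type `Σ_Λ = {x ∈ K^ℤ : Λ_{x_i, x_{i+1}} = 1 ∀ i}`, `K = Fin N`. -/
def SigmaSFT {N : ℕ} (Λ : Fin N → Fin N → Bool) : Set (ℤ → Fin N) :=
  {x | ∀ i : ℤ, Λ (x i) (x (i + 1)) = true}

/-- The cylinder `{y ∈ Σ_Λ : y_j = x_j, j = 0, ..., m}`. -/
def cylSFT {N : ℕ} (Λ : Fin N → Fin N → Bool) (x : ℤ → Fin N) (m : ℕ) : Set (ℤ → Fin N) :=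
  {y ∈ SigmaSFT Λ | ∀ j : ℕ, j ≤ m → y (j : ℤ) = x (j : ℤ)}

/-- `μ` is a Gibbs measure for `φ` with constants `c₁, c₂, p`: a shift-invariant probability
measure on `Σ_Λ` with `c₁ ≤ μ[x_0 ... x_m] / exp(-pm + ∑_{j<m} φ(S^j x)) ≤ c₂`. -/
def IsGibbs {N : ℕ} (Λ : Fin N → Fin N → Bool) (φ : (ℤ → Fin N) → ℝ)
    (μ : Measure (ℤ → Fin N)) (c₁ c₂ p : ℝ) : Prop :=
  IsProbabilityMeasure μ ∧ μ (SigmaSFT Λ) = 1 ∧ μ.map (shiftMap (Fin N)) = μ ∧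
  0 < c₁ ∧ 0 < c₂ ∧
  ∀ x ∈ SigmaSFT Λ, ∀ m : ℕ,
    c₁ * Real.exp (-(p * m) + ∑ j ∈ Finset.range m, φ (fun i => x (i + j))) ≤
        (μ (cylSFT Λ x m)).toReal ∧
      (μ (cylSFT Λ x m)).toReal ≤
        c₂ * Real.exp (-(p * m) + ∑ j ∈ Finset.range m, φ (fun i => x (i + j)))

open scoped ENNReal

/-- The centred cylinder of the configurations that agree with `x` on `[-k, k]`. -/
def centralCyl {K : Type*} (k : ℕ) (x : ℤ → K) : Set (ℤ → K) :=
  {y | ∀ j : ℤ, |j| ≤ (k : ℤ) → y j = x j}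

lemma self_mem_centralCyl {K : Type*} (k : ℕ) (x : ℤ → K) : x ∈ centralCyl k x :=
  fun _ _ => rfl

lemma centralCyl_eq_of_mem {K : Type*} {k : ℕ} {x y : ℤ → K} (h : y ∈ centralCyl k x) :
    centralCyl k y = centralCyl k x := by
  ext z
  exact forall₂_congr fun j hj => by rw [h j hj]

lemma centralCyl_eq_preimage {K : Type*} (k : ℕ) (x : ℤ → K) :
    centralCyl k x =
      (Finset.Icc (-(k : ℤ)) k).restrict (π := fun _ => K) ⁻¹'
        {(Finset.Icc (-(k : ℤ)) k).restrict x} := by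
  ext y
  simp [centralCyl, funext_iff, abs_le]

lemma measurableSet_centralCyl {N : ℕ} (k : ℕ) (x : ℤ → Fin N) :
    MeasurableSet (centralCyl k x) := by
  rw [centralCyl_eq_preimage]
  exact (Finset.measurable_restrict _) (measurableSet_singleton _)

lemma isOpen_centralCyl {N : ℕ} (k : ℕ) (x : ℤ → Fin N) : IsOpen (centralCyl k x) := by
  rw [centralCyl_eq_preimage]
  exact (isOpen_discrete _).preimage (Pi.continuous_domRestrict _)

/-- A set that is open in the product topology contains a centred cylinder around each point. -/
lemma exists_centralCyl_subset {K : Type*} [TopologicalSpace K] {U : Set (ℤ → K)}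
    (hU : IsOpen U) {x : ℤ → K} (hx : x ∈ U) : ∃ k, centralCyl k x ⊆ U := by
  obtain ⟨I, u, hu, hsub⟩ := isOpen_pi_iff.1 hU x hx
  refine ⟨I.sup Int.natAbs, fun y hy => hsub fun a ha => ?_⟩
  have h : a.natAbs ≤ I.sup Int.natAbs := Finset.le_sup (f := Int.natAbs) ha
  rw [hy a (by rw [Int.abs_eq_natAbs]; exact_mod_cast h)]
  exact (hu a ha).2

/-- Two measures whose values on centred cylinders are comparable with a constant `r` have
comparable values on unions of centred cylinders of the same length. -/
lemma measure_centralCyl_subset_le {N : ℕ} {m₁ m₂ : Measure (ℤ → Fin N)} {k : ℕ} {r : ℝ≥0∞}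
    (h : ∀ x, m₁ (centralCyl k x) ≤ r * m₂ (centralCyl k x)) (U : Set (ℤ → Fin N)) :
    m₁ {x | centralCyl k x ⊆ U} ≤ r * m₂ {x | centralCyl k x ⊆ U} := by
  classical
  set π := (Finset.Icc (-(k : ℤ)) k).restrict (π := fun _ => Fin N) with hπ
  set s : Finset (Finset.Icc (-(k : ℤ)) k → Fin N) :=
    Finset.univ.filter fun b => π ⁻¹' {b} ⊆ U with hs
  have hset : {x | centralCyl k x ⊆ U} = π ⁻¹' (s : Set _) := by
    ext x
    simp [hs, centralCyl_eq_preimage, hπ]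
  have hmeas : ∀ b ∈ s, MeasurableSet (π ⁻¹' {b}) := fun b _ =>
    (Finset.measurable_restrict _) (measurableSet_singleton _)
  rw [hset, ← sum_measure_preimage_singleton s hmeas, ← sum_measure_preimage_singleton s hmeas,
    Finset.mul_sum]
  refine Finset.sum_le_sum fun b _ => ?_
  rcases (π ⁻¹' {b}).eq_empty_or_nonempty with hb | ⟨x, rfl⟩
  · simp [hb]
  · simpa only [centralCyl_eq_preimage] using h x

/-- Measures that are asymptotically dominated on centred cylinders are dominated. -/
lemma measure_le_of_centralCyl {N : ℕ} {m₁ m₂ : Measure (ℤ → Fin N)} [IsFiniteMeasure m₂]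
    (h : ∀ ε > (0 : ℝ), ∀ᶠ k : ℕ in atTop, ∀ x,
      m₁ (centralCyl k x) ≤ ENNReal.ofReal (Real.exp ε) * m₂ (centralCyl k x)) :
    m₁ ≤ m₂ := by
  have hopen : ∀ ε > (0 : ℝ), ∀ U, IsOpen U → m₁ U ≤ ENNReal.ofReal (Real.exp ε) * m₂ U := by
    intro ε hε U hU
    have hmono : Monotone fun k : ℕ => {x | centralCyl k x ⊆ U} := fun k l hkl x hx y hy =>
      hx fun j hj => hy j (hj.trans (by exact_mod_cast hkl))
    have hunion : ⋃ k : ℕ, {x | centralCyl k x ⊆ U} = U := by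
      ext x
      simp only [Set.mem_iUnion, Set.mem_ofPred_eq]
      exact ⟨fun ⟨k, hk⟩ => hk (self_mem_centralCyl k x), exists_centralCyl_subset hU⟩
    have hlim := tendsto_measure_iUnion_atTop (μ := m₁) hmono
    rw [hunion] at hlim
    refine le_of_tendsto hlim ?_
    filter_upwards [h ε hε] with k hk
    refine (measure_centralCyl_subset_le hk U).trans ?_
    gcongr
    exact fun x hx => hx (self_mem_centralCyl k x)
  refine Measure.le_iff'.2 fun s => ?_
  have hs : ∀ ε > (0 : ℝ), m₁ s ≤ ENNReal.ofReal (Real.exp ε) * m₂ s := by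
    intro ε hε
    rw [s.measure_eq_iInf_isOpen m₂]
    rw [ENNReal.mul_iInf_of_ne (by simp [Real.exp_pos]) ENNReal.ofReal_ne_top]
    refine le_iInf fun U => ?_
    rw [ENNReal.mul_iInf_of_ne (by simp [Real.exp_pos]) ENNReal.ofReal_ne_top]
    refine le_iInf fun hsU => ?_
    rw [ENNReal.mul_iInf_of_ne (by simp [Real.exp_pos]) ENNReal.ofReal_ne_top]
    exact le_iInf fun hU => (measure_mono hsU).trans (hopen ε hε U hU)
  have hlim : Tendsto (fun ε : ℝ => ENNReal.ofReal (Real.exp ε) * m₂ s) (𝓝[>] 0) (𝓝 (m₂ s)) := by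
    have h1 : Tendsto (fun ε : ℝ => ENNReal.ofReal (Real.exp ε)) (𝓝[>] 0) (𝓝 1) := by
      have : Continuous fun ε : ℝ => ENNReal.ofReal (Real.exp ε) :=
        ENNReal.continuous_ofReal.comp Real.continuous_exp
      simpa using (this.tendsto 0).mono_left nhdsWithin_le_nhds
    simpa using ENNReal.Tendsto.mul_const h1 (Or.inl one_ne_zero)
  exact ge_of_tendsto hlim (by filter_upwards [self_mem_nhdsWithin] with ε hε using hs ε hε)

/-- A pointwise upper bound for the ratio of two measures of a set integrates. -/
lemma measure_le_mul_setLIntegral {X : Type*} [MeasurableSpace X] {μ ν : Measure X}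
    [IsFiniteMeasure μ] [IsFiniteMeasure ν]
    {C Γ : Set X} (hC : MeasurableSet C) (hΓ : MeasurableSet Γ) {r : ℝ≥0∞} (hr : r ≠ ∞)
    {D : X → ℝ≥0∞} (hempty : C ∩ Γ = ∅ → ν C = 0)
    (h : ∀ y ∈ C ∩ Γ, ν C ≤ r * (D y * μ.restrict Γ C)) :
    ν C ≤ r * ∫⁻ y in C, D y ∂(μ.restrict Γ) := by
  set m := μ.restrict Γ
  rcases (C ∩ Γ).eq_empty_or_nonempty with hne | ⟨y, hy⟩
  · simp [hempty hne]
  by_cases h0 : m C = 0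
  · have := h y hy
    rw [h0] at this
    simp_all
  have key : ∫⁻ _ in C, ν C ∂m ≤ ∫⁻ y in C, (r * m C) * D y ∂m := by
    refine setLIntegral_mono_ae' hC ?_
    filter_upwards [ae_restrict_mem hΓ] with y hyΓ hyC
    exact (h y ⟨hyC, hyΓ⟩).trans_eq (by ring)
  rw [setLIntegral_const, lintegral_const_mul' _ _ (ENNReal.mul_ne_top hr (measure_ne_top _ _))]
    at key
  rw [show r * m C * ∫⁻ y in C, D y ∂m = (r * ∫⁻ y in C, D y ∂m) * m C by ring] at key
  exact (ENNReal.mul_le_mul_iff_left h0 (measure_ne_top _ _)).1 key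

/-- A pointwise lower bound for the ratio of two measures of a set integrates. -/
lemma setLIntegral_le_mul_measure {X : Type*} [MeasurableSpace X] {μ ν : Measure X}
    [IsFiniteMeasure μ]
    {C Γ : Set X} (hC : MeasurableSet C) (hΓ : MeasurableSet Γ) {r : ℝ≥0∞}
    {D : X → ℝ≥0∞} (h : ∀ y ∈ C ∩ Γ, D y * μ.restrict Γ C ≤ r * ν C) :
    ∫⁻ y in C, D y ∂(μ.restrict Γ) ≤ r * ν C := by
  set m := μ.restrict Γ
  by_cases h0 : m C = 0
  · simp [setLIntegral_measure_zero _ _ h0]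
  have key : ∫⁻ y in C, m C * D y ∂m ≤ ∫⁻ _ in C, r * ν C ∂m := by
    refine setLIntegral_mono_ae' hC ?_
    filter_upwards [ae_restrict_mem hΓ] with y hyΓ hyC
    exact (mul_comm _ _).trans_le (h y ⟨hyC, hyΓ⟩)
  rw [setLIntegral_const, lintegral_const_mul' _ _ (measure_ne_top _ _), mul_comm] at key
  exact (ENNReal.mul_le_mul_iff_left h0 (measure_ne_top _ _)).1 key

/-- Domination by a measure with density bounds the Radon–Nikodym derivative from above. -/
lemma rnDeriv_le_of_le_withDensity {X : Type*} [MeasurableSpace X] {m ν : Measure X}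
    [SigmaFinite m] {D : X → ℝ≥0∞} (h : ν ≤ m.withDensity D) : ν.rnDeriv m ≤ᵐ[m] D := by
  refine ae_le_of_forall_setLIntegral_le_of_sigmaFinite (Measure.measurable_rnDeriv _ _)
    fun s hs _ => ?_
  rw [← withDensity_apply _ hs, ← withDensity_apply _ hs]
  exact ((Measure.withDensity_rnDeriv_le ν m).trans h) s

/-- Domination of a measure with density bounds the Radon–Nikodym derivative from below. -/
lemma le_rnDeriv_of_withDensity_le {X : Type*} [MeasurableSpace X] {m ν : Measure X}
    [SigmaFinite m] [SigmaFinite ν] {D : X → ℝ≥0∞} (hD : AEMeasurable D m) (hν : ν ≪ m)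
    (h : m.withDensity D ≤ ν) : D ≤ᵐ[m] ν.rnDeriv m := by
  refine ae_le_of_forall_setLIntegral_le_of_sigmaFinite₀ hD fun s hs _ => ?_
  rw [← withDensity_apply _ hs, ← withDensity_apply _ hs, Measure.withDensity_rnDeriv_eq _ _ hν]
  exact h s

/-- The set `Γ_σ` of the points of `Σ_Λ` whose image under `T_σ` is in `Σ_Λ`. -/
abbrev GammaSFT {N : ℕ} (Λ : Fin N → Fin N → Bool) (σ : ℤ → ℤ) : Set (ℤ → Fin N) :=
  SigmaSFT Λ ∩ Tmap σ ⁻¹' SigmaSFT Λ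

/-- The energy difference `φ(S^q T_σ x) - φ(S^q x)`. -/
abbrev energyDiff {K : Type*} (φ : (ℤ → K) → ℝ) (σ : ℤ → ℤ) (q : ℤ) (x : ℤ → K) : ℝ :=
  φ (fun i => Tmap σ x (i + q)) - φ (fun i => x (i + q))

lemma isClosed_SigmaSFT {N : ℕ} (Λ : Fin N → Fin N → Bool) : IsClosed (SigmaSFT Λ) := by
  have : SigmaSFT Λ =
      ⋂ i : ℤ, (fun x : ℤ → Fin N => (x i, x (i + 1))) ⁻¹' {a | Λ a.1 a.2 = true} := by
    ext x
    simp [SigmaSFT]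
  rw [this]
  exact isClosed_iInter fun i => (isClosed_discrete _).preimage (by fun_prop)

lemma continuous_Tmap {K : Type*} [TopologicalSpace K] (σ : ℤ → ℤ) :
    Continuous (Tmap (K := K) σ) :=
  continuous_pi fun n => continuous_apply (σ n)

lemma measurable_Tmap {K : Type*} [MeasurableSpace K] (σ : ℤ → ℤ) :
    Measurable (Tmap (K := K) σ) :=
  measurable_pi_lambda _ fun n => measurable_pi_apply (σ n)

lemma isClosed_GammaSFT {N : ℕ} (Λ : Fin N → Fin N → Bool) (σ : ℤ → ℤ) :
    IsClosed (GammaSFT Λ σ) :=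
  (isClosed_SigmaSFT Λ).inter ((isClosed_SigmaSFT Λ).preimage (continuous_Tmap σ))

lemma translate_mem_SigmaSFT {N : ℕ} {Λ : Fin N → Fin N → Bool} {x : ℤ → Fin N}
    (hx : x ∈ SigmaSFT Λ) (q : ℤ) : (fun i => x (i + q)) ∈ SigmaSFT Λ := fun i => by
  simpa [add_right_comm] using hx (i + q)

lemma Tmap_Tmap {K : Type*} {σ : ℤ → ℤ} (hσ : ∀ m, σ (σ m) = m) (x : ℤ → K) :
    Tmap σ (Tmap σ x) = x := by
  funext n
  simp [Tmap, hσ]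

/-- Exponentially small variations imply continuity. -/
lemma continuousOn_of_var_le {N : ℕ} {Λ : Fin N → Fin N → Bool} {φ : (ℤ → Fin N) → ℝ} {b α : ℝ}
    (hα : α ∈ Set.Ioo (0 : ℝ) 1)
    (hvar : ∀ k : ℕ, ∀ x ∈ SigmaSFT Λ, ∀ y ∈ SigmaSFT Λ,
      (∀ j : ℤ, |j| ≤ (k : ℤ) → x j = y j) → |φ x - φ y| ≤ b * α ^ k) :
    ContinuousOn φ (SigmaSFT Λ) := by
  intro x hx
  rw [ContinuousWithinAt, Metric.tendsto_nhds]
  intro ε hε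
  have hlim : Tendsto (fun k : ℕ => b * α ^ k) atTop (𝓝 0) := by
    simpa using (tendsto_pow_atTop_nhds_zero_of_lt_one hα.1.le hα.2).const_mul b
  obtain ⟨k, hk⟩ := (hlim.eventually (gt_mem_nhds hε)).exists
  filter_upwards [self_mem_nhdsWithin, mem_nhdsWithin_of_mem_nhds
    ((isOpen_centralCyl k x).mem_nhds (self_mem_centralCyl k x))] with y hy hyx
  exact (hvar k y hy x hx hyx).trans_lt hk

lemma continuousOn_energyDiff {N : ℕ} {Λ : Fin N → Fin N → Bool} {φ : (ℤ → Fin N) → ℝ}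
    (hφ : ContinuousOn φ (SigmaSFT Λ)) (σ : ℤ → ℤ) (q : ℤ) :
    ContinuousOn (energyDiff φ σ q) (GammaSFT Λ σ) := by
  have hS : Continuous fun (x : ℤ → Fin N) (i : ℤ) => x (i + q) := by fun_prop
  exact (hφ.comp (hS.comp (continuous_Tmap σ)).continuousOn
      fun x hx => translate_mem_SigmaSFT hx.2 q).sub
    (hφ.comp hS.continuousOn fun x hx => translate_mem_SigmaSFT hx.1 q)

lemma summable_pow_natAbs {α : ℝ} (hα : α ∈ Set.Ioo (0 : ℝ) 1) :
    Summable fun q : ℤ => α ^ q.natAbs := by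
  have := summable_geometric_of_lt_one hα.1.le hα.2
  exact Summable.of_nat_of_neg (by simpa using this) (by simpa using this)

/-- The energy differences of a finitely supported permutation are uniformly summable. -/
lemma exists_summable_bound_energyDiff {N : ℕ} {Λ : Fin N → Fin N → Bool}
    {φ : (ℤ → Fin N) → ℝ} {b α : ℝ} (hb : 0 < b) (hα : α ∈ Set.Ioo (0 : ℝ) 1)
    (hvar : ∀ k : ℕ, ∀ x ∈ SigmaSFT Λ, ∀ y ∈ SigmaSFT Λ,
      (∀ j : ℤ, |j| ≤ (k : ℤ) → x j = y j) → |φ x - φ y| ≤ b * α ^ k)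
    {σ : Equiv.Perm ℤ} (hσ : FinitelySupported σ) :
    ∃ u : ℤ → ℝ, Summable u ∧ ∀ q, ∀ x ∈ GammaSFT Λ σ, ‖energyDiff φ σ q x‖ ≤ u q := by
  obtain ⟨M, hM⟩ := hσ
  obtain ⟨B, hB⟩ := (isClosed_SigmaSFT Λ).isCompact.exists_bound_of_continuousOn
    (continuousOn_of_var_le hα hvar)
  refine ⟨fun q => (b + 2 * |B|) * (α ^ M)⁻¹ * α ^ q.natAbs,
    (summable_pow_natAbs hα).mul_left _, fun q x hx => ?_⟩
  have hTx := translate_mem_SigmaSFT hx.2 q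
  have hx' := translate_mem_SigmaSFT hx.1 q
  have hαM : 0 < α ^ M := pow_pos hα.1 M
  rcases le_total M q.natAbs with hq | hq
  · have h := hvar (q.natAbs - M) _ hTx _ hx' fun j hj => by
      simp only [Tmap]
      rw [hM]
      rw [Int.abs_eq_natAbs] at hj ⊢
      omega
    have h2 : α ^ (q.natAbs - M) = (α ^ M)⁻¹ * α ^ q.natAbs := by
      rw [pow_sub₀ _ hα.1.ne' hq, mul_comm]
    rw [h2] at h
    have h3 : 0 ≤ (α ^ M)⁻¹ * α ^ q.natAbs := by have := hα.1; positivity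
    calc ‖energyDiff φ σ q x‖ ≤ b * ((α ^ M)⁻¹ * α ^ q.natAbs) := h
      _ ≤ (b + 2 * |B|) * ((α ^ M)⁻¹ * α ^ q.natAbs) := by
        gcongr
        linarith [abs_nonneg B]
      _ = _ := by ring
  · have h1 : 1 ≤ (α ^ M)⁻¹ * α ^ q.natAbs := by
      rw [inv_mul_eq_div, one_le_div hαM]
      exact pow_le_pow_of_le_one hα.1.le hα.2.le hq
    calc ‖energyDiff φ σ q x‖ ≤ B + B := (norm_sub_le _ _).trans (add_le_add (hB _ hTx) (hB _ hx'))
      _ ≤ (b + 2 * |B|) * 1 := by linarith [le_abs_self B]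
      _ ≤ (b + 2 * |B|) * ((α ^ M)⁻¹ * α ^ q.natAbs) := by gcongr
      _ = _ := by ring

/-- The Gibbs bounds for centred cylinders, which follow by shift invariance. -/
lemma IsGibbs.centralCyl_bounds {N : ℕ} {Λ : Fin N → Fin N → Bool} {φ : (ℤ → Fin N) → ℝ}
    {μ : Measure (ℤ → Fin N)} {c₁ c₂ p : ℝ} (hG : IsGibbs Λ φ μ c₁ c₂ p)
    {x : ℤ → Fin N} (hx : x ∈ SigmaSFT Λ) (k : ℕ) :
    c₁ * Real.exp (-(p * (2 * k)) + ∑ q ∈ Finset.Ico (-(k : ℤ)) k, φ (fun i => x (i + q))) ≤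
        μ.real (centralCyl k x ∩ SigmaSFT Λ) ∧
      μ.real (centralCyl k x ∩ SigmaSFT Λ) ≤
        c₂ * Real.exp (-(p * (2 * k)) + ∑ q ∈ Finset.Ico (-(k : ℤ)) k, φ (fun i => x (i + q))) := by
  obtain ⟨-, -, hinv, -, -, hcyl⟩ := hG
  have hSm : Measurable (shiftMap (Fin N)) :=
    measurable_pi_lambda _ fun n => measurable_pi_apply (n + 1)
  have hiter : ∀ (n : ℕ) (ω : ℤ → Fin N), (shiftMap (Fin N))^[n] ω = fun i => ω (i + n) := by
    intro n
    induction n with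
    | zero => simp
    | succ n ih =>
      intro ω
      rw [Function.iterate_succ_apply, ih]
      funext i
      simp only [shiftMap, Nat.cast_succ]
      ring_nf
  have hmp : MeasurePreserving ((shiftMap (Fin N))^[k]) μ μ :=
    MeasurePreserving.iterate ⟨hSm, hinv⟩ k
  have hcentral : cylSFT Λ (fun i => x (i + -(k : ℤ))) (2 * k) =
      (shiftMap (Fin N))^[k] ⁻¹' (centralCyl k x ∩ SigmaSFT Λ) := by
    ext y
    simp only [cylSFT, Set.mem_preimage, hiter, centralCyl, Set.mem_inter_iff, Set.mem_ofPred_eq]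
    rw [and_comm]
    refine and_congr ⟨fun h j hj => ?_, fun h j hj => ?_⟩
      ⟨fun h => translate_mem_SigmaSFT h k, fun h => ?_⟩
    · have hj' := abs_le.1 hj
      have := h (j + k).toNat (by omega)
      rwa [Int.toNat_of_nonneg (by omega), add_neg_cancel_right] at this
    · have := h (j - k) (by rw [Int.abs_eq_natAbs]; omega)
      rwa [sub_add_cancel] at this
    · simpa using translate_mem_SigmaSFT h (-(k : ℤ))
  have hsum : ∑ j ∈ Finset.range (2 * k), φ (fun i => x (i + j + -(k : ℤ))) =
      ∑ q ∈ Finset.Ico (-(k : ℤ)) k, φ (fun i => x (i + q)) := by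
    refine Finset.sum_bij' (fun j _ => (j : ℤ) - k) (fun q _ => (q + k).toNat) ?_ ?_ ?_ ?_ ?_
    · intro j hj; simp at hj ⊢; omega
    · intro j hj; simp at hj ⊢; omega
    · intro j hj; simp
    · intro j hj; simp at hj ⊢; omega
    · intro j hj
      congr 1; funext i; congr 1; ring
  have := hcyl _ (translate_mem_SigmaSFT hx (-(k : ℤ))) (2 * k)
  rw [hcentral, hmp.measure_preimage ((measurableSet_centralCyl k x).inter
    (isClosed_SigmaSFT Λ).measurableSet).nullMeasurableSet] at this
  rw [hsum] at this
  exact_mod_cast this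

/-- A permutation supported in `(-M, M)` preserves `[-k, k]` when `M ≤ k`. -/
lemma abs_perm_apply_le {σ : Equiv.Perm ℤ} {M k : ℕ} (hM : ∀ n : ℤ, (M : ℤ) ≤ |n| → σ n = n)
    (hk : M ≤ k) {n : ℤ} (hn : |n| ≤ k) : |σ n| ≤ k := by
  by_contra! h
  have h1 : σ n = n := σ.injective (hM _ (by omega))
  rw [h1] at h
  omega

/-- For large `k`, a point of `Σ_Λ` agreeing on `[-k, k]` with a point of `Γ_σ` is in `Γ_σ`. -/
lemma centralCyl_inter_SigmaSFT {N : ℕ} {Λ : Fin N → Fin N → Bool} {σ : Equiv.Perm ℤ} {M k : ℕ}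
    (hM : ∀ n : ℤ, (M : ℤ) ≤ |n| → σ n = n) (hk : M ≤ k) {x : ℤ → Fin N}
    (hx : x ∈ GammaSFT Λ σ) :
    centralCyl k x ∩ SigmaSFT Λ = centralCyl k x ∩ GammaSFT Λ σ := by
  refine subset_antisymm (fun y hy => ⟨hy.1, hy.2, fun i => ?_⟩) fun y hy => ⟨hy.1, hy.2.1⟩
  have hσk := fun n : ℤ => abs_perm_apply_le hM hk (n := n)
  simp only [Tmap]
  by_cases hi : |i| ≤ k ∧ |i + 1| ≤ k
  · rw [hy.1 _ (hσk _ hi.1), hy.1 _ (hσk _ hi.2)]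
    exact hx.2 i
  · simp only [Int.abs_eq_natAbs] at hi hM
    rw [hM i (by omega), hM (i + 1) (by omega)]
    exact hy.2 i

/-- For large `k`, the map `T_σ` exchanges the centred cylinders of `x` and of `T_σ x`. -/
lemma Tmap_preimage_centralCyl {N : ℕ} {Λ : Fin N → Fin N → Bool} {σ : Equiv.Perm ℤ} {M k : ℕ}
    (hM : ∀ n : ℤ, (M : ℤ) ≤ |n| → σ n = n) (hσ : ∀ m, σ (σ m) = m) (hk : M ≤ k)
    (x : ℤ → Fin N) :
    Tmap σ ⁻¹' (centralCyl k x ∩ GammaSFT Λ σ) = centralCyl k (Tmap σ x) ∩ GammaSFT Λ σ := by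
  have hσk := fun n : ℤ => abs_perm_apply_le hM hk (n := n)
  ext y
  simp only [Set.mem_preimage, Set.mem_inter_iff, Tmap_Tmap hσ, centralCyl, Set.mem_ofPred_eq]
  rw [and_comm (a := Tmap σ y ∈ SigmaSFT Λ)]
  refine and_congr_left fun _ => ⟨fun h j hj => ?_, fun h j hj => ?_⟩
  · simpa [Tmap, hσ] using h (σ j) (hσk j hj)
  · simpa [Tmap, hσ] using h (σ j) (hσk j hj)

/-- The ratio of the measures of a centred cylinder under `μ ∘ T_σ⁻¹` and under `μ`. -/
lemma IsGibbs.map_centralCyl_bounds {N : ℕ} {Λ : Fin N → Fin N → Bool} {φ : (ℤ → Fin N) → ℝ}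
    {μ : Measure (ℤ → Fin N)} {c₁ c₂ p : ℝ} (hG : IsGibbs Λ φ μ c₁ c₂ p)
    {σ : Equiv.Perm ℤ} {M k : ℕ} (hM : ∀ n : ℤ, (M : ℤ) ≤ |n| → σ n = n)
    (hσ : ∀ m, σ (σ m) = m) (hk : M ≤ k) {x : ℤ → Fin N} (hx : x ∈ GammaSFT Λ σ) :
    c₁ / c₂ * Real.exp (∑ q ∈ Finset.Ico (-(k : ℤ)) k, energyDiff φ σ q x) *
        (μ.restrict (GammaSFT Λ σ)).real (centralCyl k x) ≤
        ((μ.map (Tmap σ)).restrict (GammaSFT Λ σ)).real (centralCyl k x) ∧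
      ((μ.map (Tmap σ)).restrict (GammaSFT Λ σ)).real (centralCyl k x) ≤
        c₂ / c₁ * Real.exp (∑ q ∈ Finset.Ico (-(k : ℤ)) k, energyDiff φ σ q x) *
        (μ.restrict (GammaSFT Λ σ)).real (centralCyl k x) := by
  have hTx : Tmap σ x ∈ GammaSFT Λ σ := ⟨hx.2, by simpa [Tmap_Tmap hσ] using hx.1⟩
  have hCm := measurableSet_centralCyl k x
  have hΓm := (isClosed_GammaSFT Λ σ).measurableSet
  have hm : (μ.restrict (GammaSFT Λ σ)).real (centralCyl k x) =
      μ.real (centralCyl k x ∩ SigmaSFT Λ) := by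
    rw [measureReal_restrict_apply hCm, centralCyl_inter_SigmaSFT hM hk hx]
  have hν : ((μ.map (Tmap σ)).restrict (GammaSFT Λ σ)).real (centralCyl k x) =
      μ.real (centralCyl k (Tmap σ x) ∩ SigmaSFT Λ) := by
    rw [measureReal_restrict_apply hCm, map_measureReal_apply (measurable_Tmap σ) (hCm.inter hΓm),
      Tmap_preimage_centralCyl hM hσ hk, centralCyl_inter_SigmaSFT hM hk hTx]
  obtain ⟨h1, h2⟩ := hG.centralCyl_bounds hx.1 k
  obtain ⟨h3, h4⟩ := hG.centralCyl_bounds hx.2 k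
  obtain ⟨-, -, -, hc₁, hc₂, -⟩ := hG
  rw [hm, hν, Finset.sum_sub_distrib, Real.exp_sub]
  simp only [Real.exp_add] at h1 h2 h3 h4
  set P := Real.exp (-(p * (2 * k)))
  set A := Real.exp (∑ q ∈ Finset.Ico (-(k : ℤ)) k, φ (fun i => x (i + q)))
  set A' := Real.exp (∑ q ∈ Finset.Ico (-(k : ℤ)) k, φ (fun i => Tmap σ x (i + q)))
  have hApos : 0 < A := Real.exp_pos _
  have hApos' : 0 < A' := Real.exp_pos _
  constructor
  · calc c₁ / c₂ * (A' / A) * μ.real (centralCyl k x ∩ SigmaSFT Λ)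
        ≤ c₁ / c₂ * (A' / A) * (c₂ * (P * A)) := by gcongr
      _ = c₁ * (P * A') := by field_simp
      _ ≤ _ := h3
  · calc μ.real (centralCyl k (Tmap σ x) ∩ SigmaSFT Λ) ≤ c₂ * (P * A') := h4
      _ = c₂ / c₁ * (A' / A) * (c₁ * (P * A)) := by field_simp
      _ ≤ _ := by gcongr

/-- the Radon–Nikodym derivative of `(μ ∘ T_σ⁻¹)|_{Γ_σ}` with respect to
`μ|_{Γ_σ}` is bounded between `(c₁/c₂)·exp(∑_{q∈ℤ}(φ(S^q T_σ x) - φ(S^q x)))` and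
`(c₂/c₁)·exp(∑_{q∈ℤ}(φ(S^q T_σ x) - φ(S^q x)))`, `μ`-a.e. on `Γ_σ`. -/
theorem gibbs_rnDeriv_bounds
    {N : ℕ} (Λ : Fin N → Fin N → Bool)
    (hsymb : ∀ j : Fin N, ∃ x ∈ SigmaSFT Λ, x 0 = j)
    (φ : (ℤ → Fin N) → ℝ)
    (hdep : ∀ x ∈ SigmaSFT Λ, ∀ y ∈ SigmaSFT Λ,
      (∀ j : ℤ, 0 ≤ j → x j = y j) → φ x = φ y)
    (b α : ℝ) (hb : 0 < b) (hα : α ∈ Set.Ioo (0 : ℝ) 1)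
    (hvar : ∀ k : ℕ, ∀ x ∈ SigmaSFT Λ, ∀ y ∈ SigmaSFT Λ,
      (∀ j : ℤ, |j| ≤ (k : ℤ) → x j = y j) → |φ x - φ y| ≤ b * α ^ k)
    (μ : Measure (ℤ → Fin N)) (c₁ c₂ p : ℝ) (hGibbs : IsGibbs Λ φ μ c₁ c₂ p)
    (σ : Equiv.Perm ℤ) (hσ : FinitelySupported σ) (hσinv : ∀ m, σ (σ m) = m)
    (hpos : 0 < μ (SigmaSFT Λ ∩ Tmap ⇑σ ⁻¹' SigmaSFT Λ)) :
    ∀ᵐ x ∂(μ.restrict (SigmaSFT Λ ∩ Tmap ⇑σ ⁻¹' SigmaSFT Λ)),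
      ENNReal.ofReal ((c₁ / c₂) *
          Real.exp (∑' q : ℤ, (φ (fun i => Tmap ⇑σ x (i + q)) - φ (fun i => x (i + q))))) ≤
        ((μ.map (Tmap ⇑σ)).restrict (SigmaSFT Λ ∩ Tmap ⇑σ ⁻¹' SigmaSFT Λ)).rnDeriv
          (μ.restrict (SigmaSFT Λ ∩ Tmap ⇑σ ⁻¹' SigmaSFT Λ)) x ∧
      ((μ.map (Tmap ⇑σ)).restrict (SigmaSFT Λ ∩ Tmap ⇑σ ⁻¹' SigmaSFT Λ)).rnDeriv
          (μ.restrict (SigmaSFT Λ ∩ Tmap ⇑σ ⁻¹' SigmaSFT Λ)) x ≤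
        ENNReal.ofReal ((c₂ / c₁) *
          Real.exp (∑' q : ℤ, (φ (fun i => Tmap ⇑σ x (i + q)) - φ (fun i => x (i + q))))) := by
  obtain ⟨M, hM⟩ := id hσ
  obtain ⟨u, hu, hub⟩ := exists_summable_bound_energyDiff hb hα hvar hσ
  have hcont := continuousOn_tsum
    (continuousOn_energyDiff (continuousOn_of_var_le hα hvar) σ) hu hub
  have hunif := tendstoUniformlyOn_tsum hu hub
  have hfin : IsProbabilityMeasure μ := hGibbs.1
  have hc₁ : 0 < c₁ := hGibbs.2.2.2.1
  have hc₂ : 0 < c₂ := hGibbs.2.2.2.2.1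
  have hΓm := (isClosed_GammaSFT Λ σ).measurableSet
  set Γ := GammaSFT Λ σ
  set E : (ℤ → Fin N) → ℝ := fun x => ∑' q : ℤ, energyDiff φ σ q x
  set m := μ.restrict Γ
  set ν := (μ.map (Tmap σ)).restrict Γ with hν
  have hνfin : IsFiniteMeasure ν := by
    have := Measure.isProbabilityMeasure_map (μ := μ) (measurable_Tmap (K := Fin N) σ).aemeasurable
    infer_instance
  have hIco : Tendsto (fun k : ℕ => Finset.Ico (-(k : ℤ)) k) atTop atTop := by
    refine tendsto_atTop_finset_of_monotone
      (fun k l hkl => Finset.Ico_subset_Ico (by omega) (by omega))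
      fun q => ⟨q.natAbs + 1, by rw [Finset.mem_Ico]; omega⟩
  have happrox : ∀ ε > (0 : ℝ), ∀ᶠ k : ℕ in atTop, ∀ x ∈ Γ,
      (c₁ / c₂ * Real.exp (E x)) * m.real (centralCyl k x) ≤
          Real.exp ε * ν.real (centralCyl k x) ∧
        ν.real (centralCyl k x) ≤
          Real.exp ε * ((c₂ / c₁ * Real.exp (E x)) * m.real (centralCyl k x)) := by
    intro ε hε
    filter_upwards [eventually_ge_atTop M,
      hIco.eventually (Metric.tendstoUniformlyOn_iff.1 hunif ε hε)] with k hk hdist x hx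
    obtain ⟨hlow, hup⟩ := hGibbs.map_centralCyl_bounds hM hσinv hk hx
    have hd := abs_lt.1 (hdist x hx)
    set Ek := ∑ q ∈ Finset.Ico (-(k : ℤ)) k, energyDiff φ σ q x
    have h1 : Real.exp (E x) ≤ Real.exp ε * Real.exp Ek := by
      rw [← Real.exp_add]
      exact Real.exp_le_exp.2 (by linarith [hd.2])
    have h2 : Real.exp Ek ≤ Real.exp ε * Real.exp (E x) := by
      rw [← Real.exp_add]
      exact Real.exp_le_exp.2 (by linarith [hd.1])
    constructor
    · calc (c₁ / c₂ * Real.exp (E x)) * m.real (centralCyl k x)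
          ≤ (c₁ / c₂ * (Real.exp ε * Real.exp Ek)) * m.real (centralCyl k x) := by gcongr
        _ = Real.exp ε * (c₁ / c₂ * Real.exp Ek * m.real (centralCyl k x)) := by ring
        _ ≤ _ := by gcongr
    · calc ν.real (centralCyl k x) ≤ c₂ / c₁ * Real.exp Ek * m.real (centralCyl k x) := hup
        _ ≤ c₂ / c₁ * (Real.exp ε * Real.exp (E x)) * m.real (centralCyl k x) := by gcongr
        _ = _ := by ring
  have hDmeas : ∀ c : ℝ, AEMeasurable (fun x => ENNReal.ofReal (c * Real.exp (E x))) m := fun c =>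
    ((hcont.aemeasurable hΓm).exp.const_mul c).ennreal_ofReal
  have hupper : ν ≤ m.withDensity fun x => ENNReal.ofReal (c₂ / c₁ * Real.exp (E x)) := by
    have : IsFiniteMeasure (m.withDensity fun x => ENNReal.ofReal (c₂ / c₁ * Real.exp (E x))) := by
      refine isFiniteMeasure_withDensity (ne_top_of_le_ne_top ?_ (setLIntegral_mono' hΓm
        (g := fun _ => ENNReal.ofReal (c₂ / c₁ * Real.exp (∑' q, u q))) fun x hx => ?_))
      · rw [setLIntegral_const]
        exact ENNReal.mul_ne_top ENNReal.ofReal_ne_top (measure_ne_top _ _)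
      · have : E x ≤ ∑' q, u q :=
          (le_abs_self _).trans (tsum_of_norm_bounded hu.hasSum fun q => hub q x hx)
        gcongr
    refine measure_le_of_centralCyl fun ε hε => ?_
    filter_upwards [happrox ε hε] with k hk x
    have hCm := measurableSet_centralCyl k x
    rw [withDensity_apply _ hCm]
    refine measure_le_mul_setLIntegral hCm hΓm ENNReal.ofReal_ne_top (fun h => ?_) fun y hy => ?_
    · rw [hν, Measure.restrict_apply hCm, h, measure_empty]
    · have h := (hk y hy.2).2
      rw [centralCyl_eq_of_mem hy.1] at h
      rw [← ofReal_measureReal, ← ofReal_measureReal, ← ENNReal.ofReal_mul (by positivity),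
        ← ENNReal.ofReal_mul (by positivity)]
      exact ENNReal.ofReal_le_ofReal h
  have hlower : (m.withDensity fun x => ENNReal.ofReal (c₁ / c₂ * Real.exp (E x))) ≤ ν := by
    refine measure_le_of_centralCyl fun ε hε => ?_
    filter_upwards [happrox ε hε] with k hk x
    have hCm := measurableSet_centralCyl k x
    rw [withDensity_apply _ hCm]
    refine setLIntegral_le_mul_measure hCm hΓm fun y hy => ?_
    have h := (hk y hy.2).1
    rw [centralCyl_eq_of_mem hy.1] at h
    rw [← ofReal_measureReal, ← ofReal_measureReal, ← ENNReal.ofReal_mul (by positivity),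
      ← ENNReal.ofReal_mul (by positivity)]
    exact ENNReal.ofReal_le_ofReal h
  have hac : ν ≪ m :=
    (Measure.absolutelyContinuous_of_le hupper).trans (withDensity_absolutelyContinuous _ _)
  filter_upwards [le_rnDeriv_of_withDensity_le (hDmeas _) hac hlower,
    rnDeriv_le_of_le_withDensity hupper] with x h1 h2
  exact ⟨h1, h2⟩
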